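/- Let U ⊂ ℝ^{n+1}_+ = {(x,y) : x ∈ ℝⁿ, y > 0} be a bounded domain with C¹ boundary such that ∂U ∩ {y = 0} is nonempty, and let α ∈ (0,1). Set q₁ = 2 + 4/n. Then for every q with 1 ≤ q < q₁/(1+2α) there exists a constant C > 0 such that for every u ∈ C¹(closure U), ‖u‖_{L^q(U)} ≤ C·( ∫_U y^{2α}|Du|² dxdy + ∫_U y^{2α}|u|² dxdy )^{1/2}. -/

import Mathlib

open MeasureTheory

section gen
variable {E : Type*} [NormedAddCommGroup E] [NormedSpace ℝ E] [MeasurableSpace E] [BorelSpace E]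
  [FiniteDimensional ℝ E]

theorem wse_A (μ : Measure E) [μ.IsAddHaarMeasure] (B : Set E) (F : E → ENNReal) (hF : Measurable F)
    (Q : ℝ) (hQ : 2 ≤ Q) (t : ℝ) (ht : 0 < t) :
    ∫⁻ x, (∫⁻ w in B, F (x + t • w) ∂μ) ^ Q ∂μ ≤
      μ B ^ (Q / 2) * μ B * ENNReal.ofReal (t ^ (-(Module.finrank ℝ E * (Q / 2 - 1)))) *
        (∫⁻ x, F x ^ 2 ∂μ) ^ (Q / 2) := by
  set d := Module.finrank ℝ E
  set I := ∫⁻ x, F x ^ 2 ∂μ with hI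
  have hm : Measurable (fun p : E × E => F (p.1 + t • p.2)) := by fun_prop
  set H : E → ENNReal := fun x => ∫⁻ w in B, F (x + t • w) ^ 2 ∂μ with hH
  have hH1 : ∀ x, H x ≤ ENNReal.ofReal (t ^ (-(d : ℝ))) * I := by
    intro x
    calc H x ≤ ∫⁻ w, F (x + t • w) ^ 2 ∂μ := setLIntegral_le_lintegral _ _
      _ = ∫⁻ w, F (x + w) ^ 2 ∂(Measure.map (fun x => t • x) μ) := by
          rw [lintegral_map (by fun_prop) (by fun_prop)]
      _ = ENNReal.ofReal (t ^ (-(d : ℝ))) * I := by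
          rw [Measure.map_addHaar_smul μ ht.ne', lintegral_smul_measure,
            lintegral_add_left_eq_self (fun w => F w ^ 2) x, smul_eq_mul, abs_of_pos (by positivity),
            Real.rpow_neg ht.le, Real.rpow_natCast]
  have hH2 : ∫⁻ x, H x ∂μ = μ B * I := by
    rw [hH, lintegral_lintegral_swap]
    · have : ∀ w, ∫⁻ x, F (x + t • w) ^ 2 ∂μ = I := fun w =>
        lintegral_add_right_eq_self (fun x => F x ^ 2) _
      simp [this, mul_comm]
    · exact (hm.pow_const 2).aemeasurable
  have hA : ∀ x, (∫⁻ w in B, F (x + t • w) ∂μ) ^ Q ≤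
      μ B ^ (Q / 2) * ((ENNReal.ofReal (t ^ (-(d : ℝ))) * I) ^ (Q / 2 - 1) * H x) := by
    intro x
    have h1 : (∫⁻ w in B, F (x + t • w) ∂μ) ≤ H x ^ (1 / 2 : ℝ) * μ B ^ (1 / 2 : ℝ) := by
      have := ENNReal.lintegral_mul_le_Lp_mul_Lq (μ.restrict B)
        (p := 2) (q := 2) Real.HolderConjugate.two_two (f := fun w => F (x + t • w)) (g := fun _ => 1)
        (by fun_prop) (by fun_prop)
      simpa [hH] using this
    calc _ ≤ (H x ^ (1 / 2 : ℝ) * μ B ^ (1 / 2 : ℝ)) ^ Q := ENNReal.rpow_le_rpow h1 (by linarith)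
      _ = μ B ^ (Q / 2) * (H x ^ (Q / 2 - 1) * H x) := by
        rw [ENNReal.mul_rpow_of_nonneg _ _ (by linarith), ← ENNReal.rpow_mul, ← ENNReal.rpow_mul,
          mul_comm]
        have : H x ^ (Q / 2 - 1) * H x = H x ^ (1 / 2 * Q) := by
          nth_rw 2 [← ENNReal.rpow_one (H x)]
          rw [← ENNReal.rpow_add_of_nonneg _ _ (by linarith) (by norm_num)]
          congr 1; ring
        rw [this]; congr 2; ring
      _ ≤ _ := by
        gcongr
        · linarith
        · exact hH1 x
  have hHm : Measurable H := by
    exact Measurable.lintegral_prod_right' (f := fun p : E × E => F (p.1 + t • p.2) ^ 2) (hm.pow_const 2)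
  calc _ ≤ ∫⁻ x, μ B ^ (Q / 2) * ((ENNReal.ofReal (t ^ (-(d : ℝ))) * I) ^ (Q / 2 - 1) * H x) ∂μ :=
        lintegral_mono hA
    _ = μ B ^ (Q / 2) * ((ENNReal.ofReal (t ^ (-(d : ℝ))) * I) ^ (Q / 2 - 1) * (μ B * I)) := by
        rw [lintegral_const_mul _ (by fun_prop), lintegral_const_mul _ hHm, hH2]
    _ = _ := by
        have e : I ^ (Q / 2) = I ^ (Q / 2 - 1) * I := by
          nth_rw 3 [← ENNReal.rpow_one I]
          rw [← ENNReal.rpow_add_of_nonneg _ _ (by linarith) (by norm_num)]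
          congr 1; ring
        rw [ENNReal.mul_rpow_of_nonneg _ _ (by linarith), e,
          ENNReal.ofReal_rpow_of_pos (by positivity), ← Real.rpow_mul ht.le]
        ring_nf

theorem wse_pow_fin (h r : ℝ) (hr : -1 < r) :
    ∫⁻ t in Set.Ioc 0 h, ENNReal.ofReal (t ^ r) ≠ ⊤ := by
  rcases le_or_gt h 0 with hh | hh
  · simp [Set.Ioc_eq_empty_of_le hh]
  have := (intervalIntegral.intervalIntegrable_rpow' (a := 0) (b := h) hr)
  rw [intervalIntegrable_iff_integrableOn_Ioc_of_le hh.le] at this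
  exact this.lintegral_lt_top.ne

theorem wse_B (μ : Measure E) [μ.IsAddHaarMeasure] (B : Set E) (hB : μ B ≠ ⊤)
    (Q : ℝ) (hQ : 2 ≤ Q) (α : ℝ) (h : ℝ)
    (hQα : Module.finrank ℝ E * (Q / 2 - 1) < Q * (1 - α)) :
    ∃ K : ENNReal, K ≠ ⊤ ∧ ∀ F : E → ENNReal, Measurable F →
      ∫⁻ x, (∫⁻ w in B, (∫⁻ t in Set.Ioc 0 h, ENNReal.ofReal (t ^ (-α)) * F (x + t • w)) ∂μ) ^ Q ∂μ ≤
      K * (∫⁻ x, F x ^ 2 ∂μ) ^ (Q / 2) := by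
  set d := Module.finrank ℝ E
  obtain ⟨β, hβ1, hβ2⟩ : ∃ β : ℝ, α * Q - Q + 1 < β ∧ β < 1 - d * (Q / 2 - 1) :=
    exists_between (by linarith)
  have hQ0 : 0 < Q := by linarith
  set P := Q / (Q - 1) with hP
  have hPQ : P.HolderConjugate Q := by
    have : Q.HolderConjugate P := Real.HolderConjugate.conjExponent (by linarith)
    exact this.symm
  have hP0 : 0 < P := hPQ.pos
  set J := ∫⁻ t in Set.Ioc 0 h, ENNReal.ofReal (t ^ ((-α + β / Q) * P)) with hJ
  have hJt : J ≠ ⊤ := by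
    apply wse_pow_fin
    rw [hP, show (-α + β / Q) * (Q / (Q - 1)) = (β - α * Q) / (Q - 1) by field_simp; ring,
      lt_div_iff₀ (by linarith)]
    linarith
  set L := ∫⁻ t in Set.Ioc 0 h, ENNReal.ofReal (t ^ (-β - d * (Q / 2 - 1))) with hL
  have hLt : L ≠ ⊤ := by
    apply wse_pow_fin; linarith
  refine ⟨J ^ (1 / P * Q) * (L * (μ B ^ (Q / 2) * μ B)), ?_, ?_⟩
  · refine ENNReal.mul_ne_top (ENNReal.rpow_ne_top_of_nonneg (by positivity) hJt)
      (ENNReal.mul_ne_top hLt (ENNReal.mul_ne_top (ENNReal.rpow_ne_top_of_nonneg (by positivity) hB) hB))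
  intro F hF
  set I := ∫⁻ x, F x ^ 2 ∂μ with hI
  set A : E → ℝ → ENNReal := fun x t => ∫⁻ w in B, F (x + t • w) ∂μ with hA
  have : IsFiniteMeasure (μ.restrict B) := ⟨by simpa using hB.lt_top⟩
  have hAm : Measurable (Function.uncurry A) := by
    have : Measurable (fun p : (E × ℝ) × E => F (p.1.1 + p.1.2 • p.2)) := by fun_prop
    exact this.lintegral_prod_right'
  have hAm2 : ∀ x, Measurable (A x) := fun x => hAm.comp measurable_prodMk_left
  have hp : ∀ x, (∫⁻ w in B, (∫⁻ t in Set.Ioc 0 h, ENNReal.ofReal (t ^ (-α)) * F (x + t • w)) ∂μ) ^ Q ≤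
      J ^ (1 / P * Q) * ∫⁻ t in Set.Ioc 0 h, ENNReal.ofReal (t ^ (-β)) * (A x t) ^ Q := by
    intro x
    have h1 : ∫⁻ w in B, (∫⁻ t in Set.Ioc 0 h, ENNReal.ofReal (t ^ (-α)) * F (x + t • w)) ∂μ
        = ∫⁻ t in Set.Ioc 0 h, ENNReal.ofReal (t ^ (-α)) * A x t := by
      rw [lintegral_lintegral_swap]
      · refine lintegral_congr fun t => ?_
        rw [lintegral_const_mul _ (by fun_prop)]
      · apply Measurable.aemeasurable
        have : Measurable (fun p : E × ℝ => ENNReal.ofReal (p.2 ^ (-α)) * F (x + p.2 • p.1)) := by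
          fun_prop
        exact this
    have h2 : ∫⁻ t in Set.Ioc 0 h, ENNReal.ofReal (t ^ (-α)) * A x t ≤
        J ^ (1 / P) * (∫⁻ t in Set.Ioc 0 h, ENNReal.ofReal (t ^ (-β)) * (A x t) ^ Q) ^ (1 / Q) := by
      have := ENNReal.lintegral_mul_le_Lp_mul_Lq (volume.restrict (Set.Ioc 0 h)) hPQ
        (f := fun t => ENNReal.ofReal (t ^ (-α + β / Q)))
        (g := fun t => ENNReal.ofReal (t ^ (-β / Q)) * A x t)
        (by fun_prop) (by have := hAm2 x; fun_prop)
      refine le_trans (le_of_eq ?_) (this.trans (le_of_eq ?_))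
      · refine setLIntegral_congr_fun measurableSet_Ioc fun t ht => ?_
        have ht0 : 0 < t := ht.1
        simp only [Pi.mul_apply]
        rw [← mul_assoc, ← ENNReal.ofReal_mul (by positivity), ← Real.rpow_add ht0]
        congr 3; ring
      · congr 2
        · refine setLIntegral_congr_fun measurableSet_Ioc fun t ht => ?_
          have ht0 : 0 < t := ht.1
          rw [ENNReal.ofReal_rpow_of_pos (by positivity), ← Real.rpow_mul ht0.le]
        · refine setLIntegral_congr_fun measurableSet_Ioc fun t ht => ?_
          have ht0 : 0 < t := ht.1
          rw [ENNReal.mul_rpow_of_nonneg _ _ hQ0.le, ENNReal.ofReal_rpow_of_pos (by positivity),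
            ← Real.rpow_mul ht0.le]
          congr 3; field_simp
    rw [h1]
    refine (ENNReal.rpow_le_rpow h2 hQ0.le).trans (le_of_eq ?_)
    rw [ENNReal.mul_rpow_of_nonneg _ _ hQ0.le, ← ENNReal.rpow_mul, ← ENNReal.rpow_mul,
      one_div_mul_cancel hQ0.ne', ENNReal.rpow_one]
  have hm3 : Measurable (fun p : E × ℝ => ENNReal.ofReal (p.2 ^ (-β)) * (A p.1 p.2) ^ Q) := by
    have : Measurable (fun p : E × ℝ => A p.1 p.2) := hAm
    fun_prop
  refine (lintegral_mono hp).trans ?_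
  rw [lintegral_const_mul _ hm3.lintegral_prod_right', mul_assoc]
  gcongr
  rw [lintegral_lintegral_swap hm3.aemeasurable, mul_assoc, hL,
    ← lintegral_mul_const _ (by fun_prop)]
  refine setLIntegral_mono_ae (by fun_prop) (Filter.Eventually.of_forall fun t ht => ?_)
  have ht0 : 0 < t := ht.1
  show ∫⁻ x, ENNReal.ofReal (t ^ (-β)) * A x t ^ Q ∂μ ≤ _
  rw [lintegral_const_mul]
  · grw [wse_A μ B F hF Q hQ t ht0]
    refine le_of_eq ?_
    rw [sub_eq_add_neg (-β), Real.rpow_add ht0, ENNReal.ofReal_mul (by positivity)]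
    ring
  · have : Measurable (fun x => A x t) := hAm.comp measurable_prodMk_right
    fun_prop

end gen

theorem wse_ftc {E : Type*} [NormedAddCommGroup E] [NormedSpace ℝ E] (U V : Set E) (hV : IsOpen V) (hUV : U ⊆ V) (u : E → ℝ) (hu : ContDiffOn ℝ 1 u V)
    (x w : E) (h : ℝ) (hh : 0 < h) (hx : ∀ t ∈ Set.Icc 0 h, x + t • w ∈ U) :
    ‖u x‖ₑ ≤ ‖u (x + h • w)‖ₑ + ‖w‖ₑ * ∫⁻ t in Set.Ioc 0 h, ‖fderiv ℝ u (x + t • w)‖ₑ := by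
  have hd : ∀ t ∈ Set.uIcc 0 h, HasDerivAt (fun t : ℝ => u (x + t • w)) (fderiv ℝ u (x + t • w) w) t := by
    intro t ht
    rw [Set.uIcc_of_le hh.le] at ht
    have h1 : HasFDerivAt u (fderiv ℝ u (x + t • w)) (x + t • w) :=
      ((hu.differentiableOn (by norm_num)).differentiableAt
        (hV.mem_nhds (hUV (hx t ht)))).hasFDerivAt
    have h2 : HasDerivAt (fun t : ℝ => x + t • w) w t := by
      simpa using ((hasDerivAt_id t).smul_const w).const_add x
    exact h1.comp_hasDerivAt t h2
  have hc : ContinuousOn (fun t : ℝ => fderiv ℝ u (x + t • w) w) (Set.uIcc 0 h) := by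
    rw [Set.uIcc_of_le hh.le]
    have : ContinuousOn (fderiv ℝ u) V := hu.continuousOn_fderiv_of_isOpen hV (by norm_num)
    exact (this.comp (by fun_prop) (fun t ht => hUV (hx t ht))).clm_apply continuousOn_const
  have key := intervalIntegral.integral_eq_sub_of_hasDerivAt hd hc.intervalIntegrable
  simp only [zero_smul, add_zero] at key
  have e : u x = u (x + h • w) + -(∫ t in (0:ℝ)..h, fderiv ℝ u (x + t • w) w) := by rw [key]; ring
  rw [e]
  refine (enorm_add_le _ _).trans ?_
  gcongr
  rw [enorm_neg, intervalIntegral.integral_of_le hh.le]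
  refine (enorm_integral_le_lintegral_enorm _).trans ?_
  rw [← lintegral_const_mul' _ _ (by simp)]
  refine lintegral_mono fun t => ?_
  rw [mul_comm]
  exact ContinuousLinearMap.le_opENorm _ _


theorem wse_cone {E : Type*} [NormedAddCommGroup E] [NormedSpace ℝ E] (U : Set E) (hUo : IsOpen U)
    (φ : E → ℝ) (hφ : ContDiff ℝ 1 φ) (hUφ : U = {p | φ p < 0})
    (hφgrad : ∀ p ∈ frontier U, fderiv ℝ φ p ≠ 0) (p : E) (hp : p ∈ closure U) :
    ∃ v : E, ∃ c > 0, ∃ δ > 0, ∃ h > 0, ∀ x ∈ U ∩ Metric.ball p δ, ∀ t ∈ Set.Icc (0 : ℝ) h,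
      ∀ w ∈ Metric.ball v c, x + t • w ∈ U := by
  by_cases hpU : p ∈ U
  · obtain ⟨ε, hε, hb⟩ := Metric.isOpen_iff.1 hUo p hpU
    refine ⟨0, 1, one_pos, ε / 2, by positivity, ε / 2, by positivity, ?_⟩
    intro x hx t ht w hw
    apply hb
    have h1 : ‖x - p‖ < ε / 2 := by simpa [dist_eq_norm] using hx.2
    have h2 : ‖w‖ < 1 := by simpa using hw
    rw [Metric.mem_ball, dist_eq_norm, add_sub_right_comm]
    have h3 : ‖t • w‖ ≤ ε / 2 := by
      rw [norm_smul, Real.norm_of_nonneg ht.1]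
      nlinarith [ht.1, ht.2, norm_nonneg w]
    linarith [norm_add_le (x - p) (t • w)]
  · have hpf : p ∈ frontier U := ⟨hp, by rwa [hUo.interior_eq]⟩
    obtain ⟨v, hv⟩ : ∃ v, fderiv ℝ φ p v < 0 := by
      by_contra! hcon
      apply hφgrad p hpf
      ext w
      have h1 := hcon w
      have h2 := hcon (-w)
      simp only [map_neg] at h2
      simp only [zero_apply]
      linarith
    have hcont : Continuous (fun z : E × E => fderiv ℝ φ z.1 z.2) := by
      have := hφ.continuous_fderiv (by norm_num)
      fun_prop
    have hop : IsOpen {z : E × E | fderiv ℝ φ z.1 z.2 < 0} := isOpen_lt hcont continuous_const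
    obtain ⟨ε, hε, hb⟩ := Metric.isOpen_iff.1 hop (p, v) hv
    refine ⟨v, ε, hε, ε / 2, by positivity, ε / (2 * (‖v‖ + ε)), by positivity, ?_⟩
    intro x hx t ht w hw
    have h1 : ‖x - p‖ < ε / 2 := by simpa [dist_eq_norm] using hx.2
    have h2 : ‖w‖ < ‖v‖ + ε := by
      have : ‖w - v‖ < ε := by simpa [dist_eq_norm] using hw
      have := norm_add_le v (w - v)
      rw [add_sub_cancel] at this
      linarith
    have hin : ∀ s ∈ Set.Icc 0 t, x + s • w ∈ Metric.ball p ε := by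
      intro s hs
      rw [Metric.mem_ball, dist_eq_norm, add_sub_right_comm]
      have h3 : ‖s • w‖ ≤ ε / 2 := by
        rw [norm_smul, Real.norm_of_nonneg hs.1]
        calc s * ‖w‖ ≤ ε / (2 * (‖v‖ + ε)) * (‖v‖ + ε) := by
              gcongr
              exact hs.2.trans ht.2
          _ = ε / 2 := by
              have : ‖v‖ + ε ≠ 0 := by positivity
              field_simp
      linarith [norm_add_le (x - p) (s • w)]
    have hd : ∀ s : ℝ, HasDerivAt (fun s : ℝ => φ (x + s • w)) (fderiv ℝ φ (x + s • w) w) s := by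
      intro s
      have h1 : HasFDerivAt φ (fderiv ℝ φ (x + s • w)) (x + s • w) :=
        ((hφ.differentiable (by norm_num)).differentiableAt).hasFDerivAt
      have h2 : HasDerivAt (fun t : ℝ => x + t • w) w s := by
        simpa using ((hasDerivAt_id s).smul_const w).const_add x
      exact h1.comp_hasDerivAt s h2
    have hanti : AntitoneOn (fun s : ℝ => φ (x + s • w)) (Set.Icc 0 t) := by
      apply antitoneOn_of_deriv_nonpos (convex_Icc 0 t)
      · exact fun s _ => (hd s).continuousAt.continuousWithinAt
      · exact fun s _ => (hd s).differentiableAt.differentiableWithinAt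
      · intro s hs
        rw [(hd s).deriv]
        have hs' := interior_subset hs
        have : (x + s • w, w) ∈ Metric.ball (p, v) ε := by
          rw [← ball_prod_same]
          exact ⟨hin s hs', hw⟩
        exact (hb this).le
    have h0 := hanti (Set.left_mem_Icc.2 ht.1) (Set.right_mem_Icc.2 ht.1) ht.1
    have hx1 := hx.1
    rw [hUφ, Set.mem_ofPred_eq] at hx1 ⊢
    simp only [zero_smul, add_zero] at h0
    linarith

/-- weighted function -/
noncomputable def wseW {n : ℕ} (α : ℝ) (U : Set ((Fin n → ℝ) × ℝ)) (a : (Fin n → ℝ) × ℝ → ENNReal) :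
    (Fin n → ℝ) × ℝ → ENNReal :=
  U.indicator (fun z => ENNReal.ofReal (z.2 ^ α) * a z)

theorem wse_W_le {n : ℕ} (α : ℝ) (hα : 0 < α) (U : Set ((Fin n → ℝ) × ℝ))
    (a : (Fin n → ℝ) × ℝ → ENNReal) (z : (Fin n → ℝ) × ℝ) (hz : z ∈ U) (s : ℝ) (hs : 0 < s)
    (hsz : s ≤ z.2) : a z ≤ ENNReal.ofReal (s ^ (-α)) * wseW α U a z := by
  rw [wseW, Set.indicator_of_mem hz, ← mul_assoc, ← ENNReal.ofReal_mul (by positivity)]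
  refine le_mul_of_one_le_left (by positivity) ?_
  rw [ENNReal.one_le_ofReal]
  calc (1 : ℝ) = s ^ (-α) * s ^ α := by rw [← Real.rpow_add hs]; simp
    _ ≤ _ := by gcongr

theorem wse_W_meas {n : ℕ} (α : ℝ) (hα : 0 < α) (U : Set ((Fin n → ℝ) × ℝ)) (hU : IsOpen U)
    (a : (Fin n → ℝ) × ℝ → ENNReal) (ha : ContinuousOn a U) : Measurable (wseW α U a) := by
  have h1 : Measurable (U.indicator a) := by
    classical
    have := ha.measurable_piecewise (continuousOn_const (c := (0:ENNReal)) (s := Uᶜ)) hU.measurableSet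
    rwa [← Set.piecewise_eq_indicator]
  have : wseW α U a = fun z => ENNReal.ofReal (z.2 ^ α) * U.indicator a z := by
    ext z
    by_cases hz : z ∈ U <;> simp [wseW, hz]
  rw [this]
  fun_prop

theorem wse_local (n : ℕ) (U : Set ((Fin n → ℝ) × ℝ))
    (hUo : IsOpen U) (hUpos : U ⊆ {p : (Fin n → ℝ) × ℝ | 0 < p.2})
    (φ : (Fin n → ℝ) × ℝ → ℝ) (hφ : ContDiff ℝ 1 φ)
    (hUφ : U = {p | φ p < 0})
    (hφgrad : ∀ p ∈ frontier U, fderiv ℝ φ p ≠ 0)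
    (α : ℝ) (hα : α ∈ Set.Ioo (0 : ℝ) 1) (Q : ℝ) (hQ : 2 ≤ Q)
    (hQα : ((n : ℝ) + 1) * (Q / 2 - 1) < Q * (1 - α))
    (p : (Fin n → ℝ) × ℝ) (hp : p ∈ closure U) :
    ∃ δ > 0, ∃ C : ENNReal, C ≠ ⊤ ∧ ∀ (u : (Fin n → ℝ) × ℝ → ℝ) (V : Set ((Fin n → ℝ) × ℝ)),
      IsOpen V → U ⊆ V → ContDiffOn ℝ 1 u V →
      ∫⁻ z in U ∩ Metric.ball p δ, ‖u z‖ₑ ^ Q ≤ C *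
        ((∫⁻ z, wseW α U (fun z => ‖fderiv ℝ u z‖ₑ) z ^ 2) +
          (∫⁻ z, wseW α U (fun z => ‖u z‖ₑ) z ^ 2)) ^ (Q / 2) := by
  have : (volume : Measure ((Fin n → ℝ) × ℝ)).IsAddHaarMeasure :=
    Measure.prod.instIsAddHaarMeasure _ _
  have hdim : Module.finrank ℝ ((Fin n → ℝ) × ℝ) = n + 1 := by simp
  obtain ⟨v, c, hc, δ, hδ, h, hh, hcone⟩ := wse_cone U hUo φ hφ hUφ hφgrad p hp
  refine ⟨δ, hδ, ?_⟩
  set B : Set ((Fin n → ℝ) × ℝ) := Metric.ball v (c / 2) with hB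
  have hBt : volume B ≠ ⊤ := measure_ball_lt_top.ne
  have hB0 : volume B ≠ 0 := (Metric.measure_ball_pos _ _ (by positivity)).ne'
  obtain ⟨K, hK, hKF⟩ := wse_B (volume : Measure ((Fin n → ℝ) × ℝ)) B hBt Q hQ α h
    (by rw [hdim]; push_cast; exact hQα)
  have hQ0 : 0 < Q := by linarith
  set K₀ : ENNReal := volume B ^ (Q / 2) * volume B *
    ENNReal.ofReal (h ^ (-(Module.finrank ℝ ((Fin n → ℝ) × ℝ) * (Q / 2 - 1)))) with hK₀
  have hK₀t : K₀ ≠ ⊤ := by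
    refine ENNReal.mul_ne_top (ENNReal.mul_ne_top ?_ hBt) ENNReal.ofReal_ne_top
    exact ENNReal.rpow_ne_top_of_nonneg (by positivity) hBt
  have hy : ∀ x ∈ U ∩ Metric.ball p δ, ∀ t ∈ Set.Icc (0 : ℝ) h, ∀ w ∈ B,
      c / 4 * t ≤ (x + t • w).2 := by
    intro x hx t ht w hw
    have h1 : w - (0, c / 4) ∈ Metric.ball v c := by
      have h2 : dist w v < c / 2 := hw
      rw [dist_eq_norm] at h2
      rw [Metric.mem_ball, dist_eq_norm, sub_right_comm]
      have h3 := norm_sub_le (w - v) ((0, c / 4) : (Fin n → ℝ) × ℝ)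
      have h4 : ‖((0, c / 4) : (Fin n → ℝ) × ℝ)‖ = c / 4 := by
        simp [Prod.norm_def, abs_of_pos hc]; positivity
      linarith
    have h5 := hUpos (hcone x hx t ht _ h1)
    simp at h5 ⊢
    nlinarith
  set c₁ : ENNReal := ENNReal.ofReal ((c / 4 * h) ^ (-α)) with hc₁
  set c₂ : ENNReal := ENNReal.ofReal (‖v‖ + c) * ENNReal.ofReal ((c / 4) ^ (-α)) with hc₂
  have hc₂t : c₂ ≠ ⊤ := ENNReal.mul_ne_top ENNReal.ofReal_ne_top ENNReal.ofReal_ne_top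
  refine ⟨((volume B)⁻¹) ^ Q * (2 ^ (Q - 1) * (c₁ ^ Q * K₀ + c₂ ^ Q * K)), ?_, ?_⟩
  · refine ENNReal.mul_ne_top (ENNReal.rpow_ne_top_of_nonneg hQ0.le (by simpa using hB0)) ?_
    refine ENNReal.mul_ne_top (ENNReal.rpow_ne_top_of_nonneg (by linarith) (by simp)) ?_
    refine ENNReal.add_ne_top.2 ⟨ENNReal.mul_ne_top ?_ hK₀t, ENNReal.mul_ne_top ?_ hK⟩
    · exact ENNReal.rpow_ne_top_of_nonneg hQ0.le ENNReal.ofReal_ne_top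
    · exact ENNReal.rpow_ne_top_of_nonneg hQ0.le hc₂t
  intro u V hV hUV hu
  set f := wseW α U (fun z => ‖u z‖ₑ) with hf
  set g := wseW α U (fun z => ‖fderiv ℝ u z‖ₑ) with hg
  have hfm : Measurable f := wse_W_meas α hα.1 U hUo _ ((hu.continuousOn.mono hUV).enorm)
  have hgm : Measurable g := wse_W_meas α hα.1 U hUo _
    (((hu.continuousOn_fderiv_of_isOpen hV (by norm_num)).mono hUV).enorm)
  have hptw : ∀ x ∈ U ∩ Metric.ball p δ, ∀ w ∈ B,
      ‖u x‖ₑ ≤ c₁ * f (x + h • w) +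
        c₂ * ∫⁻ t in Set.Ioc 0 h, ENNReal.ofReal (t ^ (-α)) * g (x + t • w) := by
    intro x hx w hw
    have hwc : w ∈ Metric.ball v c := Metric.ball_subset_ball (by linarith) hw
    refine (wse_ftc U V hV hUV u hu x w h hh (fun t ht => hcone x hx t ht w hwc)).trans ?_
    refine add_le_add ?_ ?_
    · exact wse_W_le α hα.1 U (fun z => ‖u z‖ₑ) _ (hcone x hx h ⟨hh.le, le_rfl⟩ w hwc) _
        (by positivity) (hy x hx h ⟨hh.le, le_rfl⟩ w hw)
    · rw [hc₂, mul_assoc]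
      refine mul_le_mul' ?_ ?_
      · rw [← ofReal_norm]
        apply ENNReal.ofReal_le_ofReal
        have : ‖w - v‖ < c := by simpa [dist_eq_norm] using hwc
        have := norm_add_le v (w - v)
        rw [add_sub_cancel] at this
        linarith
      · rw [← lintegral_const_mul' _ _ ENNReal.ofReal_ne_top]
        refine setLIntegral_mono' measurableSet_Ioc fun t ht => ?_
        have ht0 : 0 < t := ht.1
        rw [← mul_assoc, ← ENNReal.ofReal_mul (by positivity),
          ← Real.mul_rpow (by positivity) (by positivity)]
        exact wse_W_le α hα.1 U (fun z => ‖fderiv ℝ u z‖ₑ) _ (hcone x hx t ⟨ht0.le, ht.2⟩ w hwc) _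
          (by positivity) (hy x hx t ⟨ht0.le, ht.2⟩ w hw)
  set A₁ : (Fin n → ℝ) × ℝ → ENNReal := fun x => ∫⁻ w in B, f (x + h • w) with hA₁
  set A₂ : (Fin n → ℝ) × ℝ → ENNReal := fun x => ∫⁻ w in B,
    (∫⁻ t in Set.Ioc 0 h, ENNReal.ofReal (t ^ (-α)) * g (x + t • w)) with hA₂
  have hA₁m : Measurable A₁ := by
    have : Measurable (fun p : ((Fin n → ℝ) × ℝ) × ((Fin n → ℝ) × ℝ) => f (p.1 + h • p.2)) := by
      fun_prop
    exact this.lintegral_prod_right'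
  have havg : ∀ x ∈ U ∩ Metric.ball p δ, ‖u x‖ₑ ≤ (volume B)⁻¹ * (c₁ * A₁ x + c₂ * A₂ x) := by
    intro x hx
    have h1 : ∫⁻ w in B, ‖u x‖ₑ ≤ ∫⁻ w in B, (c₁ * f (x + h • w) +
        c₂ * ∫⁻ t in Set.Ioc 0 h, ENNReal.ofReal (t ^ (-α)) * g (x + t • w)) :=
      setLIntegral_mono' Metric.isOpen_ball.measurableSet (hptw x hx)
    rw [lintegral_add_left (by fun_prop), lintegral_const_mul' _ _ ENNReal.ofReal_ne_top,
      lintegral_const_mul' _ _ hc₂t, setLIntegral_const, mul_comm] at h1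
    calc ‖u x‖ₑ = (volume B)⁻¹ * (volume B * ‖u x‖ₑ) := by
          rw [← mul_assoc, ENNReal.inv_mul_cancel hB0 hBt, one_mul]
      _ ≤ _ := by gcongr
  have hpow : ∀ x ∈ U ∩ Metric.ball p δ, ‖u x‖ₑ ^ Q ≤ ((volume B)⁻¹) ^ Q *
      (2 ^ (Q - 1) * (c₁ ^ Q * A₁ x ^ Q + c₂ ^ Q * A₂ x ^ Q)) := by
    intro x hx
    refine (ENNReal.rpow_le_rpow (havg x hx) hQ0.le).trans ?_
    rw [ENNReal.mul_rpow_of_nonneg _ _ hQ0.le]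
    gcongr
    refine (ENNReal.rpow_add_le_mul_rpow_add_rpow _ _ (by linarith)).trans ?_
    rw [ENNReal.mul_rpow_of_nonneg _ _ hQ0.le, ENNReal.mul_rpow_of_nonneg _ _ hQ0.le]
  have hms : MeasurableSet (U ∩ Metric.ball p δ) :=
    (hUo.inter Metric.isOpen_ball).measurableSet
  have hV0 : ((volume B)⁻¹) ^ Q ≠ ⊤ :=
    ENNReal.rpow_ne_top_of_nonneg hQ0.le (by simpa using hB0)
  have h20 : (2 : ENNReal) ^ (Q - 1) ≠ ⊤ := ENNReal.rpow_ne_top_of_nonneg (by linarith) (by simp)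
  have hc1Q : c₁ ^ Q ≠ ⊤ := ENNReal.rpow_ne_top_of_nonneg hQ0.le ENNReal.ofReal_ne_top
  have hc2Q : c₂ ^ Q ≠ ⊤ := ENNReal.rpow_ne_top_of_nonneg hQ0.le hc₂t
  refine (setLIntegral_mono' hms hpow).trans ?_
  refine (setLIntegral_le_lintegral _ _).trans ?_
  rw [lintegral_const_mul' _ _ hV0, lintegral_const_mul' _ _ h20,
    lintegral_add_left (by fun_prop), lintegral_const_mul' _ _ hc1Q, lintegral_const_mul' _ _ hc2Q,
    mul_assoc, mul_assoc, add_mul, mul_assoc (c₁ ^ Q), mul_assoc (c₂ ^ Q)]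
  have e1 := wse_A volume B f hfm Q hQ h hh
  have e2 := hKF g hgm
  refine mul_le_mul' le_rfl (mul_le_mul' le_rfl (add_le_add (mul_le_mul' le_rfl ?_)
    (mul_le_mul' le_rfl ?_)))
  · refine e1.trans (mul_le_mul' le_rfl (ENNReal.rpow_le_rpow le_add_self (by positivity)))
  · refine e2.trans (mul_le_mul' le_rfl (ENNReal.rpow_le_rpow le_self_add (by positivity)))

theorem wse_global (n : ℕ) (U : Set ((Fin n → ℝ) × ℝ))
    (hUo : IsOpen U) (hUb : Bornology.IsBounded U)
    (hUpos : U ⊆ {p : (Fin n → ℝ) × ℝ | 0 < p.2})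
    (φ : (Fin n → ℝ) × ℝ → ℝ) (hφ : ContDiff ℝ 1 φ)
    (hUφ : U = {p | φ p < 0})
    (hφgrad : ∀ p ∈ frontier U, fderiv ℝ φ p ≠ 0)
    (α : ℝ) (hα : α ∈ Set.Ioo (0 : ℝ) 1) (Q : ℝ) (hQ : 2 ≤ Q)
    (hQα : ((n : ℝ) + 1) * (Q / 2 - 1) < Q * (1 - α)) :
    ∃ C : ENNReal, C ≠ ⊤ ∧ ∀ (u : (Fin n → ℝ) × ℝ → ℝ) (V : Set ((Fin n → ℝ) × ℝ)),
      IsOpen V → U ⊆ V → ContDiffOn ℝ 1 u V →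
      ∫⁻ z in U, ‖u z‖ₑ ^ Q ≤ C *
        ((∫⁻ z, wseW α U (fun z => ‖fderiv ℝ u z‖ₑ) z ^ 2) +
          (∫⁻ z, wseW α U (fun z => ‖u z‖ₑ) z ^ 2)) ^ (Q / 2) := by
  have key := hUb.isCompact_closure.induction_on (p := fun S => ∃ C : ENNReal, C ≠ ⊤ ∧
    ∀ (u : (Fin n → ℝ) × ℝ → ℝ) (V : Set ((Fin n → ℝ) × ℝ)),
      IsOpen V → U ⊆ V → ContDiffOn ℝ 1 u V →
      ∫⁻ z in U ∩ S, ‖u z‖ₑ ^ Q ≤ C *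
        ((∫⁻ z, wseW α U (fun z => ‖fderiv ℝ u z‖ₑ) z ^ 2) +
          (∫⁻ z, wseW α U (fun z => ‖u z‖ₑ) z ^ 2)) ^ (Q / 2))
    ⟨0, by simp, by simp⟩ ?_ ?_ ?_
  · simpa [Set.inter_eq_left.2 (subset_closure (s := U))] using key
  · rintro s t hst ⟨C, hC, hCu⟩
    exact ⟨C, hC, fun u V h1 h2 h3 => (lintegral_mono_set (by gcongr)).trans (hCu u V h1 h2 h3)⟩
  · rintro s t ⟨C, hC, hCu⟩ ⟨D, hD, hDu⟩
    refine ⟨C + D, by simp [hC, hD], fun u V h1 h2 h3 => ?_⟩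
    rw [Set.inter_union_distrib_left, add_mul]
    exact (lintegral_union_le _ _ _).trans (add_le_add (hCu u V h1 h2 h3) (hDu u V h1 h2 h3))
  · intro p hp
    obtain ⟨δ, hδ, C, hC, hCu⟩ := wse_local n U hUo hUpos φ hφ hUφ hφgrad α hα Q hQ hQα p hp
    exact ⟨Metric.ball p δ, mem_nhdsWithin_of_mem_nhds (Metric.ball_mem_nhds p hδ), C, hC, hCu⟩

theorem wse_conv {n : ℕ} (α : ℝ) (hα : 0 < α) (U : Set ((Fin n → ℝ) × ℝ))
    (hUo : IsOpen U) (hUb : Bornology.IsBounded U)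
    (hUpos : U ⊆ {p : (Fin n → ℝ) × ℝ | 0 < p.2})
    {F : Type*} [NormedAddCommGroup F] (a : (Fin n → ℝ) × ℝ → F) (ha : ContinuousOn a (closure U)) :
    ∫⁻ z, wseW α U (fun z => ‖a z‖ₑ) z ^ 2 =
      ENNReal.ofReal (∫ z in U, z.2 ^ (2 * α) * ‖a z‖ ^ 2) := by
  have hc : ContinuousOn (fun z : (Fin n → ℝ) × ℝ => z.2 ^ (2 * α) * ‖a z‖ ^ 2) (closure U) := by
    have : Continuous (fun z : (Fin n → ℝ) × ℝ => z.2 ^ (2 * α)) :=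
      (Real.continuous_rpow_const (by positivity)).comp continuous_snd
    exact this.continuousOn.mul (ha.norm.pow 2)
  have hi : IntegrableOn (fun z : (Fin n → ℝ) × ℝ => z.2 ^ (2 * α) * ‖a z‖ ^ 2) U :=
    (hc.integrableOn_compact hUb.isCompact_closure).mono_set subset_closure
  rw [ofReal_integral_eq_lintegral_ofReal hi, ← lintegral_indicator hUo.measurableSet]
  · refine lintegral_congr fun z => ?_
    by_cases hz : z ∈ U
    · have hz0 : 0 < z.2 := hUpos hz
      simp only [wseW, Set.indicator_of_mem hz]
      rw [mul_pow, ENNReal.ofReal_mul (by positivity), ← ENNReal.ofReal_pow (by positivity),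
        ← ofReal_norm, ← ENNReal.ofReal_pow (by positivity), ← Real.rpow_natCast,
        ← Real.rpow_mul hz0.le]
      congr 3
      push_cast; ring
    · simp [wseW, hz]
  · refine (ae_restrict_iff' hUo.measurableSet).2 (Filter.Eventually.of_forall fun z hz => ?_)
    have hz0 : 0 < z.2 := hUpos hz
    simp only [Pi.zero_apply]
    positivity

theorem weighted_sobolev_embedding_L2 (n : ℕ) (hn : 1 ≤ n) (U : Set ((Fin n → ℝ) × ℝ))
    (hUo : IsOpen U) (hUconn : IsConnected U) (hUb : Bornology.IsBounded U)
    (hUpos : U ⊆ {p : (Fin n → ℝ) × ℝ | 0 < p.2})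
    (φ : (Fin n → ℝ) × ℝ → ℝ) (hφ : ContDiff ℝ 1 φ)
    (hUφ : U = {p | φ p < 0})
    (hφgrad : ∀ p ∈ frontier U, fderiv ℝ φ p ≠ 0)
    (hfr : (frontier U ∩ {p : (Fin n → ℝ) × ℝ | p.2 = 0}).Nonempty)
    (α : ℝ) (hα : α ∈ Set.Ioo (0 : ℝ) 1)
    (q : ℝ) (hq₁ : 1 ≤ q) (hq₂ : q < (2 + 4 / n) / (1 + 2 * α)) :
    ∃ C > 0, ∀ (u : (Fin n → ℝ) × ℝ → ℝ) (V : Set ((Fin n → ℝ) × ℝ)),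
      IsOpen V → closure U ⊆ V → ContDiffOn ℝ 1 u V →
      (∫ z in U, |u z| ^ q) ^ (1 / q) ≤ C *
        ((∫ z in U, z.2 ^ (2 * α) * ‖fderiv ℝ u z‖ ^ 2) +
          (∫ z in U, z.2 ^ (2 * α) * |u z| ^ 2)) ^ ((1 : ℝ) / 2) := by
  have hα0 := hα.1
  have hα1 := hα.2
  have hn1 : (1 : ℝ) ≤ n := by exact_mod_cast hn
  obtain ⟨Q, hQ, hqQ, hQα⟩ : ∃ Q : ℝ, 2 ≤ Q ∧ q ≤ Q ∧ ((n : ℝ) + 1) * (Q / 2 - 1) < Q * (1 - α) := by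
    rcases le_or_gt q 2 with h | h
    · exact ⟨2, le_rfl, h, by norm_num; linarith⟩
    · refine ⟨q, h.le, le_rfl, ?_⟩
      rw [lt_div_iff₀ (by positivity)] at hq₂
      have h1 : q * (1 + 2 * α) * n < 2 * n + 4 := by
        calc q * (1 + 2 * α) * n < (2 + 4 / n) * n := by gcongr
          _ = 2 * n + 4 := by field_simp
      have h2 : q * ((n + 2) * (n - 1 + 2 * α)) ≤ q * ((n + 1) * n * (1 + 2 * α)) := by
        refine mul_le_mul_of_nonneg_left ?_ (by linarith)
        nlinarith [mul_nonneg hα0.le (by nlinarith : (0:ℝ) ≤ n * n - 1)]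
      have h3 : q * ((n + 2) * (n - 1 + 2 * α)) < (n + 2) * (2 * (n + 1)) := by nlinarith
      have h4 : q * (n - 1 + 2 * α) < 2 * (n + 1) := by
        have : (n + 2 : ℝ) * (q * (n - 1 + 2 * α)) < (n + 2) * (2 * (n + 1)) := by linarith
        exact lt_of_mul_lt_mul_left this (by positivity)
      nlinarith
  obtain ⟨C, hC, hCu⟩ := wse_global n U hUo hUb hUpos φ hφ hUφ hφgrad α hα Q hQ hQα
  have hQ0 : 0 < Q := by linarith
  have hq0 : 0 < q := by linarith
  have hUfin : volume U ≠ ⊤ := hUb.measure_lt_top.ne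
  set D : ENNReal := C ^ (1 / Q) * volume U ^ (1 / q - 1 / Q) with hD
  have hDt : D ≠ ⊤ := by
    refine ENNReal.mul_ne_top (ENNReal.rpow_ne_top_of_nonneg (by positivity) hC)
      (ENNReal.rpow_ne_top_of_nonneg ?_ hUfin)
    have := one_div_le_one_div_of_le hq0 hqQ
    linarith
  refine ⟨D.toReal + 1, by positivity, ?_⟩
  intro u V hV hUV hu
  have hUV' : U ⊆ V := subset_closure.trans hUV
  have huc : ContinuousOn u (closure U) := hu.continuousOn.mono hUV
  have hdc : ContinuousOn (fderiv ℝ u) (closure U) :=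
    (hu.continuousOn_fderiv_of_isOpen hV (by norm_num)).mono hUV
  have hum : AEStronglyMeasurable u (volume.restrict U) :=
    (huc.mono subset_closure).aestronglyMeasurable hUo.measurableSet
  have e := hCu u V hV hUV' hu
  rw [wse_conv α hα0 U hUo hUb hUpos _ hdc, wse_conv α hα0 U hUo hUb hUpos _ huc] at e
  simp only [Real.norm_eq_abs] at e
  set I₁ := ∫ z in U, z.2 ^ (2 * α) * ‖fderiv ℝ u z‖ ^ 2 with hI₁
  set I₂ := ∫ z in U, z.2 ^ (2 * α) * |u z| ^ 2 with hI₂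
  have hI₁0 : 0 ≤ I₁ := setIntegral_nonneg hUo.measurableSet fun z hz => by
    have hz0 : 0 < z.2 := hUpos hz
    positivity
  have hI₂0 : 0 ≤ I₂ := setIntegral_nonneg hUo.measurableSet fun z hz => by
    have hz0 : 0 < z.2 := hUpos hz
    positivity
  rw [← ENNReal.ofReal_add hI₁0 hI₂0] at e
  have hle : eLpNorm' u q (volume.restrict U) ≤ D * ENNReal.ofReal ((I₁ + I₂) ^ ((1 : ℝ) / 2)) := by
    refine (eLpNorm'_le_eLpNorm'_mul_rpow_measure_univ hq0 hqQ hum).trans ?_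
    rw [Measure.restrict_apply_univ, eLpNorm'_eq_lintegral_enorm]
    calc _ ≤ (C * ENNReal.ofReal (I₁ + I₂) ^ (Q / 2)) ^ (1 / Q) * volume U ^ (1 / q - 1 / Q) := by
          gcongr
      _ = _ := by
          rw [ENNReal.mul_rpow_of_nonneg _ _ (by positivity), ← ENNReal.rpow_mul, hD,
            ← ENNReal.ofReal_rpow_of_nonneg (by positivity) (by positivity)]
          rw [show Q / 2 * (1 / Q) = 1 / 2 by field_simp]
          ring
  have hl : (∫ z in U, |u z| ^ q) ^ (1 / q) = (eLpNorm' u q (volume.restrict U)).toReal := by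
    rw [eLpNorm'_eq_lintegral_enorm, ← ENNReal.toReal_rpow, integral_eq_lintegral_of_nonneg_ae]
    · congr 2
      refine lintegral_congr fun z => ?_
      rw [← ENNReal.ofReal_rpow_of_nonneg (abs_nonneg _) hq0.le, ← Real.norm_eq_abs, ofReal_norm]
    · exact Filter.Eventually.of_forall fun z => by simp only [Pi.zero_apply]; positivity
    · have := hum.aemeasurable
      exact (AEMeasurable.aestronglyMeasurable (by simp only [← Real.norm_eq_abs]; fun_prop))
  rw [hl]
  calc _ ≤ (D * ENNReal.ofReal ((I₁ + I₂) ^ ((1 : ℝ) / 2))).toReal :=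
        ENNReal.toReal_mono (ENNReal.mul_ne_top hDt ENNReal.ofReal_ne_top) hle
    _ = D.toReal * (I₁ + I₂) ^ ((1 : ℝ) / 2) := by
        rw [ENNReal.toReal_mul, ENNReal.toReal_ofReal (by positivity)]
    _ ≤ _ := by gcongr; linarith
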